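/- arXiv:0710.1870 — 2 statements merged into one kernel-verified Lean document; each statement's English description precedes it below -/
import Mathlib

section
/- Let G be a graph with n ≥ 5 nodes and vector-valued edge weights g_{i,j} = (g¹_{i,j}, g²_{i,j}) ∈ ℝ² (and no node weights). Suppose that for every pairwise distinct i, j, k ∈ {1,…,n} and every pairwise distinct m, p, q, r ∈ {1,…,n}: g¹_{i,j} + g¹_{j,k} ≠ g¹_{m,p} + g¹_{q,r}, g²_{i,j} + g²_{j,k} ≠ g²_{m,p} + g²_{q,r}, and g¹_{i,j} + g²_{j,k} ≠ g¹_{m,p} + g²_{q,r}. Then G is reconstructible from the five one-dimensional distributions D_{g¹}(G), D_{g²}(G), D_{α¹}(G), D_{α²}(G) and D_{α¹²}(G): every graph G' with n nodes and edge weights in ℝ² for which these five distributions agree with those of G is isomorphic to G. -/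
/-- The multiset of (scalar) edge weights `f{i,j}` over unordered pairs
`{i,j}`, `i ≠ j`. -/
def edgeDist {n : ℕ} {X : Type*} (f : Sym2 (Fin n) → X) : Multiset X :=
  ((Finset.univ : Finset (Fin n × Fin n)).filter (fun p => p.1 < p.2)).val.map
    (fun p => f s(p.1, p.2))

/-- The multiset of mixed sums of adjacent edge weights
`f{i,j} + h{j,k}` over triples of pairwise distinct `i, j, k`.  Taking
`f = h` gives the distribution of sums of adjacent edge weights. -/
def mixAdjDist {n : ℕ} {X : Type*} [Add X] (f h : Sym2 (Fin n) → X) :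
    Multiset X :=
  ((Finset.univ : Finset (Fin n × Fin n × Fin n)).filter
      (fun p => p.1 ≠ p.2.1 ∧ p.2.1 ≠ p.2.2 ∧ p.1 ≠ p.2.2)).val.map
    (fun p => f s(p.1, p.2.1) + h s(p.2.1, p.2.2))

/-- Two graphs with edge weights and no node weights are isomorphic if there is
a permutation `π` of the nodes with `g'{i,j} = g{π i, π j}` for all `i ≠ j`. -/
def EdgeGraphIso {n : ℕ} {X : Type*} (g g' : Sym2 (Fin n) → X) : Prop :=
  ∃ π : Equiv.Perm (Fin n), ∀ i j : Fin n, i ≠ j → g' s(i, j) = g s(π i, π j)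

theorem exists_ne_of_five_le_card {V : Type*} [Fintype V] (hV : 5 ≤ Fintype.card V)
    (a b c d : V) : ∃ x, x ≠ a ∧ x ≠ b ∧ x ≠ c ∧ x ≠ d := by
  classical
  obtain ⟨x, -, hx⟩ : ∃ x ∈ (Finset.univ : Finset V), x ∉ ({a, b, c, d} : Finset V) :=
    Finset.exists_mem_notMem_of_card_lt_card
      (Finset.card_le_four.trans_lt (by rw [Finset.card_univ]; omega))
  exact ⟨x, by simpa using hx⟩

/-- The image of a vertex star under an injective map preserving adjacency of edges is again
contained in a vertex star. -/
theorem exists_mem_forall_star {V : Type*} [Fintype V] (hV : 5 ≤ Fintype.card V)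
    {φ : Sym2 V → Sym2 V} (hφ : Function.Injective φ)
    (hadj : ∀ i j k : V, i ≠ j → j ≠ k → i ≠ k → ∃ v, v ∈ φ s(i, j) ∧ v ∈ φ s(j, k)) (v : V) :
    ∃ w, ∀ u, u ≠ v → w ∈ φ s(v, u) := by
  have key : ∀ x y, x ≠ v → y ≠ v → x ≠ y → ∃ w, w ∈ φ s(v, x) ∧ w ∈ φ s(v, y) := by
    intro x y hx hy hxy
    have := hadj x v y hx hy.symm hxy
    rwa [Sym2.eq_swap] at this
  have hne : ∀ x y, x ≠ y → φ s(v, x) ≠ φ s(v, y) := by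
    intro x y hxy h
    exact hxy (Sym2.congr_right.1 (hφ h))
  obtain ⟨x, hx, -⟩ := exists_ne_of_five_le_card hV v v v v
  obtain ⟨y, hy, hyx, -⟩ := exists_ne_of_five_le_card hV v x x x
  obtain ⟨a, hax, hay⟩ := key x y hx hy hyx.symm
  by_contra! hcon
  obtain ⟨z, hz, haz⟩ := hcon a
  have hzx : z ≠ x := by rintro rfl; exact haz hax
  have hzy : z ≠ y := by rintro rfl; exact haz hay
  obtain ⟨t, ht, htx, hty, htz⟩ := exists_ne_of_five_le_card hV v x y z
  obtain ⟨b, hb⟩ := Sym2.mem_iff_exists.1 hax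
  obtain ⟨c, hc⟩ := Sym2.mem_iff_exists.1 hay
  have hxy' := hne x y hyx.symm
  obtain ⟨p, hpx, hpz⟩ := key x z hx hz hzx.symm
  obtain ⟨q, hqy, hqz⟩ := key y z hy hz hzy.symm
  obtain ⟨r, hrx, hrt⟩ := key x t hx ht htx.symm
  obtain ⟨r', hry, hrt'⟩ := key y t hy ht hty.symm
  obtain ⟨r'', hrz, hrt''⟩ := key z t hz ht htz.symm
  have h1 := hne x t htx.symm
  have h2 := hne y t hty.symm
  have h3 := hne z t htz.symm
  have hbc : b ≠ c := by rintro rfl; exact hxy' (hb.trans hc.symm)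
  rw [hb, Sym2.mem_iff] at hpx hrx
  rw [hc, Sym2.mem_iff] at hqy hry
  have hpb : p = b := hpx.resolve_left (by rintro rfl; exact haz hpz)
  have hqc : q = c := hqy.resolve_left (by rintro rfl; exact haz hqz)
  subst hpb hqc
  have hzpq : φ s(v, z) = s(p, q) := (Sym2.mem_and_mem_iff hbc).1 ⟨hpz, hqz⟩
  have hap : a ≠ p := by rintro rfl; exact haz hpz
  have haq : a ≠ q := by rintro rfl; exact haz hqz
  rw [hzpq, Sym2.mem_iff] at hrz
  rw [hb] at h1
  rw [hc] at h2
  rw [hzpq] at h3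
  have e1 := fun h => h1 ((Sym2.mem_and_mem_iff hap).1 h).symm
  have e2 := fun h => h2 ((Sym2.mem_and_mem_iff haq).1 h).symm
  have e3 := fun h => h3 ((Sym2.mem_and_mem_iff hbc).1 h).symm
  grind

/-- An injective self-map of the edges of a complete graph on at least five vertices which
preserves adjacency of edges is induced by a permutation of the vertices. -/
theorem exists_perm_of_edge_adj {V : Type*} [Fintype V] (hV : 5 ≤ Fintype.card V)
    {φ : Sym2 V → Sym2 V} (hφ : Function.Injective φ)
    (hdiag : ∀ e, ¬ e.IsDiag → ¬ (φ e).IsDiag)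
    (hadj : ∀ i j k : V, i ≠ j → j ≠ k → i ≠ k → ∃ v, v ∈ φ s(i, j) ∧ v ∈ φ s(j, k)) :
    ∃ π : Equiv.Perm V, ∀ i j, i ≠ j → φ s(i, j) = s(π i, π j) := by
  classical
  choose π hπ using exists_mem_forall_star hV hφ hadj
  have hinj : Function.Injective π := by
    intro u v huv
    by_contra hne
    have hex : ∀ x, ∃ y, x ≠ u → φ s(u, x) = s(π u, y) := by
      intro x
      by_cases hx : x = u
      · exact ⟨u, fun h => (h hx).elim⟩
      · obtain ⟨y, hy⟩ := Sym2.mem_iff_exists.1 (hπ u x hx)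
        exact ⟨y, fun _ => hy⟩
    choose ρ hρ using hex
    have hρu : ∀ x, x ≠ u → ρ x ≠ π u := by
      intro x hx h
      apply hdiag s(u, x) (by simpa using hx.symm)
      rw [hρ x hx, h]
      simp
    let τ : V → V := fun x => if x = u then π u else ρ x
    have hτ : Function.Injective τ := by
      intro x y hxy
      by_cases hx : x = u <;> by_cases hy : y = u
      · rw [hx, hy]
      · simp only [τ, hx, hy, if_true, if_false] at hxy
        exact (hρu y hy hxy.symm).elim
      · simp only [τ, hx, hy, if_true, if_false] at hxy
        exact (hρu x hx hxy).elim
      · simp only [τ, hx, hy, if_false] at hxy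
        have : φ s(u, x) = φ s(u, y) := by rw [hρ x hx, hρ y hy, hxy]
        exact Sym2.congr_right.1 (hφ this)
    obtain ⟨x, hxu, hxv, -⟩ := exists_ne_of_five_le_card hV u v v v
    obtain ⟨z, hz⟩ := Sym2.mem_iff_exists.1 (hπ v x hxv)
    obtain ⟨y, hy⟩ := (Finite.injective_iff_surjective.1 hτ) z
    have hyu : y ≠ u := by
      rintro rfl
      apply hdiag s(v, x) (by simpa using hxv.symm)
      simp only [τ, if_true] at hy
      rw [hz, ← hy, huv]
      simp
    simp only [τ, hyu, if_false] at hy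
    have : φ s(v, x) = φ s(u, y) := by rw [hz, hρ y hyu, hy, huv]
    have := hφ this
    rw [Sym2.eq_iff] at this
    grind
  refine ⟨Equiv.ofBijective π (Finite.injective_iff_bijective.1 hinj), fun i j hij => ?_⟩
  exact (Sym2.mem_and_mem_iff (hinj.ne hij)).1
    ⟨hπ i j hij.symm, by rw [Sym2.eq_swap]; exact hπ j i hij⟩

theorem exists_perm_of_map_univ_eq {α β : Type*} [Fintype α] {f g : α → β}
    (h : (Finset.univ : Finset α).val.map f = (Finset.univ : Finset α).val.map g) :
    ∃ σ : Equiv.Perm α, ∀ a, f a = g (σ a) := by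
  classical
  have hcard : ∀ c, Nonempty ({a // f a = c} ≃ {a // g a = c}) := by
    intro c
    have hc := congrArg (Multiset.count c) h
    rw [Multiset.count_map, Multiset.count_map, ← Finset.filter_val, ← Finset.filter_val,
      Finset.card_val, Finset.card_val] at hc
    rw [← Fintype.card_eq, Fintype.card_subtype, Fintype.card_subtype]
    simpa only [eq_comm] using hc
  exact ⟨Equiv.ofFiberEquiv fun c => (hcard c).some,
    fun a => (Equiv.ofFiberEquiv_map _ a).symm⟩

theorem edgeDist_eq_map_univ {n : ℕ} {X : Type*} (f : Sym2 (Fin n) → X) :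
    edgeDist f =
      (Finset.univ : Finset {e : Sym2 (Fin n) // ¬ e.IsDiag}).val.map (f ∘ Subtype.val) := by
  have hset : (Finset.univ : Finset {e : Sym2 (Fin n) // ¬ e.IsDiag}).map
        (Function.Embedding.subtype _) =
      ((Finset.univ : Finset (Fin n × Fin n)).filter (fun p => p.1 < p.2)).image
        (fun p => s(p.1, p.2)) := by
    ext e
    induction e with | _ i j
    simp only [Finset.mem_map, Finset.mem_univ, true_and, Finset.mem_image, Finset.mem_filter,
      Function.Embedding.subtype_apply, Subtype.exists, exists_prop, exists_eq_right,
      Sym2.mk_isDiag_iff, Prod.exists]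
    constructor
    · intro h
      rcases lt_or_gt_of_ne h with h | h
      · exact ⟨i, j, h, rfl⟩
      · exact ⟨j, i, h, Sym2.eq_swap⟩
    · rintro ⟨a, b, h, hab⟩
      rw [Sym2.eq_iff] at hab
      grind
  have hval := congrArg Finset.val hset
  rw [Finset.map_val, Finset.image_val_of_injOn] at hval
  · have := congrArg (Multiset.map f) hval
    simpa only [edgeDist, Multiset.map_map, Function.comp_def, Function.Embedding.subtype_apply]
      using this.symm
  · rintro ⟨a, b⟩ hab ⟨c, d⟩ hcd h
    simp only [Finset.coe_filter, Finset.mem_univ, true_and, Set.mem_ofPred_eq] at hab hcd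
    simp only [Sym2.eq_iff] at h
    grind

theorem exists_perm_of_edgeDist_eq {n : ℕ} {X : Type*} {f f' : Sym2 (Fin n) → X}
    (h : edgeDist f' = edgeDist f) :
    ∃ φ : Equiv.Perm (Sym2 (Fin n)), (∀ e, ¬ e.IsDiag → ¬ (φ e).IsDiag) ∧
      ∀ e, ¬ e.IsDiag → f' e = f (φ e) := by
  rw [edgeDist_eq_map_univ, edgeDist_eq_map_univ] at h
  obtain ⟨σ, hσ⟩ := exists_perm_of_map_univ_eq h
  have happ : ∀ e (he : ¬ e.IsDiag), Equiv.Perm.ofSubtype σ e = σ ⟨e, he⟩ := fun e he =>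
    Equiv.Perm.ofSubtype_apply_of_mem σ he
  refine ⟨Equiv.Perm.ofSubtype σ, fun e he => ?_, fun e he => ?_⟩
  · rw [happ e he]
    exact (σ ⟨e, he⟩).2
  · rw [happ e he]
    exact hσ ⟨e, he⟩

/-- If sums over adjacent edges never coincide with sums over disjoint edges, then edge
correspondences between graphs with equal adjacent-sum distributions send adjacent edges to
intersecting edges. -/
theorem exists_mem_of_mixAdjDist_eq {n : ℕ} {X : Type*} [Add X] {f h f' h' : Sym2 (Fin n) → X}
    (hyp : ∀ i j k m p q r : Fin n, i ≠ j → j ≠ k → i ≠ k →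
      m ≠ p → m ≠ q → m ≠ r → p ≠ q → p ≠ r → q ≠ r →
      f s(i, j) + h s(j, k) ≠ f s(m, p) + h s(q, r))
    (hmix : mixAdjDist f' h' = mixAdjDist f h) {φ ψ : Sym2 (Fin n) → Sym2 (Fin n)}
    (hφd : ∀ e, ¬ e.IsDiag → ¬ (φ e).IsDiag) (hψd : ∀ e, ¬ e.IsDiag → ¬ (ψ e).IsDiag)
    (hφ : ∀ e, ¬ e.IsDiag → f' e = f (φ e)) (hψ : ∀ e, ¬ e.IsDiag → h' e = h (ψ e))
    (i j k : Fin n) (hij : i ≠ j) (hjk : j ≠ k) (hik : i ≠ k) :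
    ∃ v, v ∈ φ s(i, j) ∧ v ∈ ψ s(j, k) := by
  have hmem : f' s(i, j) + h' s(j, k) ∈ mixAdjDist f' h' :=
    Multiset.mem_map.2 ⟨(i, j, k), by simp [hij, hjk, hik], rfl⟩
  rw [hmix] at hmem
  obtain ⟨⟨a, b, c⟩, habc, hsum⟩ := Multiset.mem_map.1 hmem
  simp only [Finset.mem_val, Finset.mem_filter, Finset.mem_univ, true_and] at habc
  have h1 : ¬ s(i, j).IsDiag := by simpa using hij
  have h2 : ¬ s(j, k).IsDiag := by simpa using hjk
  rw [hφ _ h1, hψ _ h2] at hsum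
  have d1 := hφd _ h1
  have d2 := hψd _ h2
  generalize φ s(i, j) = e at *
  generalize ψ s(j, k) = e' at *
  induction e with | _ m p
  induction e' with | _ q r
  by_contra! hcon
  simp only [Sym2.mk_isDiag_iff] at d1 d2
  simp only [Sym2.mem_iff] at hcon
  exact hyp a b c m p q r habc.1 habc.2.1 habc.2.2 d1 (by grind) (by grind) (by grind)
    (by grind) d2 hsum

/-- Two vertex permutations sending any two adjacent edges to intersecting edges agree. -/
theorem perm_eq_of_forall_adj {V : Type*} [Fintype V] (hV : 5 ≤ Fintype.card V)
    (π₁ π₂ : Equiv.Perm V)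
    (hadj : ∀ i j k : V, i ≠ j → j ≠ k → i ≠ k →
      ∃ v, v ∈ s(π₁ i, π₁ j) ∧ v ∈ s(π₂ j, π₂ k)) : π₁ = π₂ := by
  ext j
  by_contra hne
  obtain ⟨k, hkj, hk, -⟩ := exists_ne_of_five_le_card hV j (π₂.symm (π₁ j)) j j
  obtain ⟨i, hij, hik, hi2, hi3⟩ :=
    exists_ne_of_five_le_card hV j k (π₁.symm (π₂ j)) (π₁.symm (π₂ k))
  obtain ⟨v, hv1, hv2⟩ := hadj i j k hij hkj.symm hik
  rw [Sym2.mem_iff] at hv1 hv2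
  rw [Ne, Equiv.eq_symm_apply] at hk hi2 hi3
  grind

/-- A `(2,0)`-attribute graph with `n ≥ 5` nodes and edge weights
`g{i,j} = (g¹{i,j}, g²{i,j}) ∈ ℝ²` satisfying the three genericity conditions
is reconstructible from the five one-dimensional distributions
`D_{g¹}, D_{g²}, D_{α¹}, D_{α²}, D_{α¹²}`. -/
theorem reconstructible_two_attribute {n : ℕ} (hn : 5 ≤ n)
    (g : Sym2 (Fin n) → ℝ × ℝ)
    (hyp : ∀ i j k m p q r : Fin n,
      i ≠ j → j ≠ k → i ≠ k →
      m ≠ p → m ≠ q → m ≠ r → p ≠ q → p ≠ r → q ≠ r →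
      ((g s(i, j)).1 + (g s(j, k)).1 ≠ (g s(m, p)).1 + (g s(q, r)).1) ∧
      ((g s(i, j)).2 + (g s(j, k)).2 ≠ (g s(m, p)).2 + (g s(q, r)).2) ∧
      ((g s(i, j)).1 + (g s(j, k)).2 ≠ (g s(m, p)).1 + (g s(q, r)).2)) :
    ∀ g' : Sym2 (Fin n) → ℝ × ℝ,
      edgeDist (fun p => (g' p).1) = edgeDist (fun p => (g p).1) →
      edgeDist (fun p => (g' p).2) = edgeDist (fun p => (g p).2) →
      mixAdjDist (fun p => (g' p).1) (fun p => (g' p).1) =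
        mixAdjDist (fun p => (g p).1) (fun p => (g p).1) →
      mixAdjDist (fun p => (g' p).2) (fun p => (g' p).2) =
        mixAdjDist (fun p => (g p).2) (fun p => (g p).2) →
      mixAdjDist (fun p => (g' p).1) (fun p => (g' p).2) =
        mixAdjDist (fun p => (g p).1) (fun p => (g p).2) →
      EdgeGraphIso g g' := by
  intro g' hg1 hg2 hα1 hα2 hα12
  have hV : 5 ≤ Fintype.card (Fin n) := by simpa using hn
  obtain ⟨φ, hφd, hφ⟩ := exists_perm_of_edgeDist_eq hg1
  obtain ⟨ψ, hψd, hψ⟩ := exists_perm_of_edgeDist_eq hg2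
  obtain ⟨π₁, hπ₁⟩ := exists_perm_of_edge_adj hV φ.injective hφd
    (exists_mem_of_mixAdjDist_eq
      (fun i j k m p q r h₁ h₂ h₃ h₄ h₅ h₆ h₇ h₈ h₉ =>
        (hyp i j k m p q r h₁ h₂ h₃ h₄ h₅ h₆ h₇ h₈ h₉).1) hα1 hφd hφd hφ hφ)
  obtain ⟨π₂, hπ₂⟩ := exists_perm_of_edge_adj hV ψ.injective hψd
    (exists_mem_of_mixAdjDist_eq
      (fun i j k m p q r h₁ h₂ h₃ h₄ h₅ h₆ h₇ h₈ h₉ =>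
        (hyp i j k m p q r h₁ h₂ h₃ h₄ h₅ h₆ h₇ h₈ h₉).2.1) hα2 hψd hψd hψ hψ)
  have hπ : π₁ = π₂ := by
    refine perm_eq_of_forall_adj hV π₁ π₂ fun i j k hij hjk hik => ?_
    rw [← hπ₁ i j hij, ← hπ₂ j k hjk]
    exact exists_mem_of_mixAdjDist_eq
      (fun i j k m p q r h₁ h₂ h₃ h₄ h₅ h₆ h₇ h₈ h₉ =>
        (hyp i j k m p q r h₁ h₂ h₃ h₄ h₅ h₆ h₇ h₈ h₉).2.2) hα12 hφd hψd hφ hψ i j k hij hjk hik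
  subst hπ
  refine ⟨π₁, fun i j hij => ?_⟩
  have hd : ¬ s(i, j).IsDiag := by simpa using hij
  refine Prod.ext ?_ ?_
  · simpa only [hπ₁ i j hij] using hφ _ hd
  · simpa only [hπ₂ i j hij] using hψ _ hd
end

section
/- Let d₁, d₂ be positive integers and let G be a graph with n ≥ 5 nodes, with edge weights g_{i,j} ∈ ℝ^{d₁} on unordered pairs of distinct nodes and node weights w_i ∈ ℝ^{d₂}. Assume that for every pairwise distinct i, j, k ∈ {1,…,n} and every pairwise distinct m, p, q, r ∈ {1,…,n}: (a) w^l_i + w^l_j + w^{l+1}_j + w^{l+1}_k ≠ w^l_m + w^l_p + w^{l+1}_q + w^{l+1}_r for all l = 1,…,d₂−1; (b) g^l_{i,j} + g^{l+1}_{j,k} ≠ g^l_{m,p} + g^{l+1}_{q,r} for all l = 1,…,d₁−1; and (c) w¹_i + w¹_j + g¹_{j,k} ≠ w¹_m + w¹_p + g¹_{q,r}. Then G is reconstructible from the following one-dimensional distributions: D_{w^l}(G) for l = 1,…,d₂; D_{β^{l,l+1}}(G) for l = 1,…,d₂−1; D_{g^l}(G) for l = 1,…,d₁; D_{α^{l,l+1}}(G)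 for l = 1,…,d₁−1; and D_{Δ¹}(G). That is, every graph G' with n nodes, edge weights in ℝ^{d₁} and node weights in ℝ^{d₂} for which all these distributions agree with those of G is isomorphic to G. -/
/-- The multiset of (scalar) node weights `v i` over the nodes `i`. -/
def nodeWeightDist {n : ℕ} {X : Type*} (v : Fin n → X) : Multiset X :=
  (Finset.univ : Finset (Fin n)).val.map v

/-- The multiset of the quantities `u i + u j + v j + v k` over triples of
pairwise distinct `i, j, k`; with `u = w^l` and `v = w^{l+1}` this is the
distribution of the `β^{l,l+1}_{i,j,k}`. -/
def betaDist {n : ℕ} {X : Type*} [Add X] (u v : Fin n → X) : Multiset X :=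
  ((Finset.univ : Finset (Fin n × Fin n × Fin n)).filter
      (fun p => p.1 ≠ p.2.1 ∧ p.2.1 ≠ p.2.2 ∧ p.1 ≠ p.2.2)).val.map
    (fun p => u p.1 + u p.2.1 + v p.2.1 + v p.2.2)

/-- The multiset of the quantities `Δ_{i,j,k} = v i + v j + f{j,k}` over
triples of pairwise distinct `i, j, k`; with `v = w¹`, `f = g¹` this is the
distribution of the `Δ¹_{i,j,k}`. -/
def deltaDist {n : ℕ} {X : Type*} [Add X] (v : Fin n → X)
    (f : Sym2 (Fin n) → X) : Multiset X :=
  ((Finset.univ : Finset (Fin n × Fin n × Fin n)).filter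
      (fun p => p.1 ≠ p.2.1 ∧ p.2.1 ≠ p.2.2 ∧ p.1 ≠ p.2.2)).val.map
    (fun p => v p.1 + v p.2.1 + f s(p.2.1, p.2.2))

/-- Two graphs with edge weights and node weights are isomorphic if there is a
permutation `π` of the nodes with `g'{i,j} = g{π i, π j}` for all `i ≠ j` and
`w' i = w (π i)` for all `i`. -/
def FullGraphIso {n : ℕ} {X Y : Type*} (g g' : Sym2 (Fin n) → X)
    (w w' : Fin n → Y) : Prop :=
  ∃ π : Equiv.Perm (Fin n),
    (∀ i j : Fin n, i ≠ j → g' s(i, j) = g s(π i, π j)) ∧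
    (∀ i : Fin n, w' i = w (π i))

/-- The edge weights `u i + u j` induced by the node weights `u`. -/
def nodeSum {n : ℕ} {X : Type*} [AddCommMagma X] (u : Fin n → X) : Sym2 (Fin n) → X :=
  Sym2.lift ⟨fun i j => u i + u j, fun i j => add_comm (u i) (u j)⟩

theorem betaDist_eq_mixAdjDist {n : ℕ} {X : Type*} [AddCommSemigroup X] (u v : Fin n → X) :
    betaDist u v = mixAdjDist (nodeSum u) (nodeSum v) := by
  simp [betaDist, mixAdjDist, nodeSum, add_assoc]

theorem deltaDist_eq_mixAdjDist {n : ℕ} {X : Type*} [AddCommMagma X] (v : Fin n → X)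
    (f : Sym2 (Fin n) → X) : deltaDist v f = mixAdjDist (nodeSum v) f := by
  simp [deltaDist, mixAdjDist, nodeSum]

theorem mem_mixAdjDist {n : ℕ} {X : Type*} [Add X] {f h : Sym2 (Fin n) → X} {x : X} :
    x ∈ mixAdjDist f h ↔
      ∃ i j k, i ≠ j ∧ j ≠ k ∧ i ≠ k ∧ f s(i, j) + h s(j, k) = x := by
  simp [mixAdjDist, and_assoc]

theorem exists_perm_of_nodeWeightDist_eq {n : ℕ} {X : Type*} {v v' : Fin n → X}
    (h : nodeWeightDist v' = nodeWeightDist v) : ∃ σ : Equiv.Perm (Fin n), ∀ i, v' i = v (σ i) := by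
  classical
  have hcard : ∀ x, Fintype.card {i // v' i = x} = Fintype.card {i // v i = x} := by
    intro x
    have hcount := congrArg (Multiset.count x) h
    simp only [nodeWeightDist, Multiset.count_map, ← Finset.filter_val, Finset.card_val] at hcount
    simpa only [Fintype.card_subtype, eq_comm] using hcount
  exact ⟨Equiv.ofFiberEquiv fun x => Fintype.equivOfCardEq (hcard x),
    fun i => (Equiv.ofFiberEquiv_map _ i).symm⟩

theorem mem_edgeDist {n : ℕ} {X : Type*} {f : Sym2 (Fin n) → X} {x : X} :
    x ∈ edgeDist f ↔ ∃ a b, a ≠ b ∧ f s(a, b) = x := by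
  simp only [edgeDist, Multiset.mem_map, Finset.mem_val, Finset.mem_filter, Finset.mem_univ,
    true_and, Prod.exists]
  constructor
  · rintro ⟨a, b, hab, rfl⟩
    exact ⟨a, b, hab.ne, rfl⟩
  · rintro ⟨a, b, hab, rfl⟩
    rcases hab.lt_or_gt with hab | hab
    · exact ⟨a, b, hab, rfl⟩
    · exact ⟨b, a, hab, by rw [Sym2.eq_swap]⟩

/-- Mixed sums over adjacent edges never agree with mixed sums over disjoint edges. -/
def AdjSeparated {n : ℕ} {X : Type*} [Add X] (f h : Sym2 (Fin n) → X) : Prop :=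
  ∀ i j k m p q r : Fin n, i ≠ j → j ≠ k → i ≠ k →
    m ≠ p → m ≠ q → m ≠ r → p ≠ q → p ≠ r → q ≠ r →
    f s(i, j) + h s(j, k) ≠ f s(m, p) + h s(q, r)

/-- If `f'` is `f` relabelled by `π`, then an edge of the second graph carrying the `h`-weight of
`{c, d}` must be sent to `{c, d}` by `π`. -/
theorem AdjSeparated.eq_map_of_apply_eq {n : ℕ} (hn : 5 ≤ n) {X : Type*} [Add X]
    {f h f' h' : Sym2 (Fin n) → X} (hsep : AdjSeparated f h)
    (hmix : mixAdjDist f' h' = mixAdjDist f h) (π : Equiv.Perm (Fin n))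
    (hf : ∀ i j, i ≠ j → f' s(i, j) = f s(π i, π j)) {a b c d : Fin n} (hab : a ≠ b)
    (hcd : c ≠ d) (hh : h' s(a, b) = h s(c, d)) : s(c, d) = s(π a, π b) := by
  obtain ⟨y, hy⟩ : ∃ y, y ∉ ({π a, π b, c, d} : Finset (Fin n)) := by
    by_contra! hall
    have := Finset.card_le_card (fun y _ => hall y : Finset.univ ⊆ ({π a, π b, c, d} : Finset _))
    have := Finset.card_le_four (a := π a) (b := π b) (c := c) (d := d)
    simp only [Finset.card_univ, Fintype.card_fin] at *
    omega
  obtain ⟨x, rfl⟩ := π.surjective y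
  simp only [Finset.mem_insert, Finset.mem_singleton, not_or, π.injective.eq_iff] at hy
  obtain ⟨hxa, hxb, hxc, hxd⟩ := hy
  have meets : ∀ a b, a ≠ b → x ≠ a → x ≠ b → h' s(a, b) = h s(c, d) → π a = c ∨ π a = d := by
    intro a b hab hxa hxb hh
    by_contra! hne
    have hmem : f' s(x, a) + h' s(a, b) ∈ mixAdjDist f h :=
      hmix ▸ mem_mixAdjDist.mpr ⟨x, a, b, hxa, hab, hxb, rfl⟩
    obtain ⟨i, j, k, hij, hjk, hik, heq⟩ := mem_mixAdjDist.mp hmem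
    rw [hf x a hxa, hh] at heq
    exact hsep i j k (π x) (π a) c d hij hjk hik (π.injective.ne hxa) hxc hxd hne.1 hne.2 hcd heq
  have ha := meets a b hab hxa hxb hh
  have hb := meets b a hab.symm hxb hxa (by rw [Sym2.eq_swap, hh])
  have := π.injective.ne hab
  rw [Sym2.eq_iff]
  grind

theorem AdjSeparated.apply_eq_of_edgeDist_eq {n : ℕ} (hn : 5 ≤ n) {X : Type*} [Add X]
    {f h f' h' : Sym2 (Fin n) → X} (hsep : AdjSeparated f h)
    (hmix : mixAdjDist f' h' = mixAdjDist f h) (hedge : edgeDist h' = edgeDist h)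
    (π : Equiv.Perm (Fin n)) (hf : ∀ i j, i ≠ j → f' s(i, j) = f s(π i, π j))
    (a b : Fin n) (hab : a ≠ b) : h' s(a, b) = h s(π a, π b) := by
  obtain ⟨c, d, hcd, hh⟩ := mem_edgeDist.mp (hedge ▸ mem_edgeDist.mpr ⟨a, b, hab, rfl⟩)
  rw [← hh, hsep.eq_map_of_apply_eq hn hmix π hf hab hcd hh.symm]

theorem perm_eq_of_forall_pair_eq {n : ℕ} (hn : 3 ≤ n) {σ π : Equiv.Perm (Fin n)}
    (h : ∀ a b, a ≠ b → s(σ a, σ b) = s(π a, π b)) : σ = π := by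
  ext1 a
  obtain ⟨b, hb⟩ : ∃ b, b ≠ a := by
    have : Nontrivial (Fin n) := Fin.nontrivial_iff_two_le.mpr (by omega)
    exact exists_ne a
  obtain ⟨c, hc⟩ : ∃ c, c ∉ ({a, b} : Finset (Fin n)) := by
    by_contra! hall
    have := Finset.card_le_card (fun y _ => hall y : Finset.univ ⊆ ({a, b} : Finset _))
    have := Finset.card_le_two (a := a) (b := b)
    simp only [Finset.card_univ, Fintype.card_fin] at *
    omega
  simp only [Finset.mem_insert, Finset.mem_singleton, not_or] at hc
  have hab := Sym2.eq_iff.mp (h a b hb.symm)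
  have hac := Sym2.eq_iff.mp (h a c (Ne.symm hc.1))
  have hbc : π b ≠ π c := π.injective.ne (Ne.symm hc.2)
  grind

theorem AdjSeparated.apply_eq_of_nodeWeightDist_eq {n : ℕ} (hn : 5 ≤ n) {X : Type*}
    [AddCommMagma X] {f f' : Sym2 (Fin n) → X} {v v' : Fin n → X}
    (hsep : AdjSeparated f (nodeSum v))
    (hmix : mixAdjDist f' (nodeSum v') = mixAdjDist f (nodeSum v))
    (hnode : nodeWeightDist v' = nodeWeightDist v) (π : Equiv.Perm (Fin n))
    (hf : ∀ i j, i ≠ j → f' s(i, j) = f s(π i, π j)) (a : Fin n) : v' a = v (π a) := by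
  obtain ⟨σ, hσ⟩ := exists_perm_of_nodeWeightDist_eq hnode
  have hσπ : σ = π := perm_eq_of_forall_pair_eq (by omega) fun a b hab =>
    hsep.eq_map_of_apply_eq hn hmix π hf hab (σ.injective.ne hab) (by simp [nodeSum, hσ])
  rw [hσ, hσπ]

/-- A graph with `n ≥ 5` nodes, edge weights in `ℝ^{d₁}` and node weights in
`ℝ^{d₂}`, satisfying the genericity conditions (a), (b), (c), is
reconstructible from the one-dimensional distributions `D_{w^l}`
(`l = 1,…,d₂`), `D_{β^{l,l+1}}` (`l = 1,…,d₂-1`), `D_{g^l}` (`l = 1,…,d₁`),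
`D_{α^{l,l+1}}` (`l = 1,…,d₁-1`) and `D_{Δ¹}`. -/
theorem reconstructible_edge_and_node_weights {n d₁ d₂ : ℕ} (hn : 5 ≤ n)
    (hd₁ : 0 < d₁) (hd₂ : 0 < d₂)
    (g : Sym2 (Fin n) → (Fin d₁ → ℝ)) (w : Fin n → (Fin d₂ → ℝ))
    (hypa : ∀ i j k m p q r : Fin n,
      i ≠ j → j ≠ k → i ≠ k →
      m ≠ p → m ≠ q → m ≠ r → p ≠ q → p ≠ r → q ≠ r →
      ∀ (l : Fin d₂) (hl : l.val + 1 < d₂),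
        w i l + w j l + w j ⟨l.val + 1, hl⟩ + w k ⟨l.val + 1, hl⟩ ≠
          w m l + w p l + w q ⟨l.val + 1, hl⟩ + w r ⟨l.val + 1, hl⟩)
    (hypb : ∀ i j k m p q r : Fin n,
      i ≠ j → j ≠ k → i ≠ k →
      m ≠ p → m ≠ q → m ≠ r → p ≠ q → p ≠ r → q ≠ r →
      ∀ (l : Fin d₁) (hl : l.val + 1 < d₁),
        g s(i, j) l + g s(j, k) ⟨l.val + 1, hl⟩ ≠
          g s(m, p) l + g s(q, r) ⟨l.val + 1, hl⟩)
    (hypc : ∀ i j k m p q r : Fin n,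
      i ≠ j → j ≠ k → i ≠ k →
      m ≠ p → m ≠ q → m ≠ r → p ≠ q → p ≠ r → q ≠ r →
      w i ⟨0, hd₂⟩ + w j ⟨0, hd₂⟩ + g s(j, k) ⟨0, hd₁⟩ ≠
        w m ⟨0, hd₂⟩ + w p ⟨0, hd₂⟩ + g s(q, r) ⟨0, hd₁⟩) :
    ∀ (g' : Sym2 (Fin n) → (Fin d₁ → ℝ)) (w' : Fin n → (Fin d₂ → ℝ)),
      (∀ l : Fin d₂,
        nodeWeightDist (fun i => w' i l) = nodeWeightDist (fun i => w i l)) →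
      (∀ (l : Fin d₂) (hl : l.val + 1 < d₂),
        betaDist (fun i => w' i l) (fun i => w' i ⟨l.val + 1, hl⟩) =
          betaDist (fun i => w i l) (fun i => w i ⟨l.val + 1, hl⟩)) →
      (∀ l : Fin d₁,
        edgeDist (fun p => g' p l) = edgeDist (fun p => g p l)) →
      (∀ (l : Fin d₁) (hl : l.val + 1 < d₁),
        mixAdjDist (fun p => g' p l) (fun p => g' p ⟨l.val + 1, hl⟩) =
          mixAdjDist (fun p => g p l) (fun p => g p ⟨l.val + 1, hl⟩)) →
      deltaDist (fun i => w' i ⟨0, hd₂⟩) (fun p => g' p ⟨0, hd₁⟩) =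
        deltaDist (fun i => w i ⟨0, hd₂⟩) (fun p => g p ⟨0, hd₁⟩) →
      FullGraphIso g g' w w' := by
  intro g' w' hnode hbeta hedge halpha hdelta
  obtain ⟨π, hπ⟩ := exists_perm_of_nodeWeightDist_eq (hnode ⟨0, hd₂⟩)
  have hw : ∀ (l : ℕ) (hl : l < d₂) (i : Fin n), w' i ⟨l, hl⟩ = w (π i) ⟨l, hl⟩ := by
    intro l
    induction l with
    | zero => exact fun _ => hπ
    | succ l ih =>
      intro hl
      have hsep : AdjSeparated (nodeSum fun i => w i ⟨l, by omega⟩)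
          (nodeSum fun i => w i ⟨l + 1, hl⟩) := by
        intro i j k m p q r h₁ h₂ h₃ h₄ h₅ h₆ h₇ h₈ h₉
        simpa [nodeSum, add_assoc] using
          hypa i j k m p q r h₁ h₂ h₃ h₄ h₅ h₆ h₇ h₈ h₉ ⟨l, by omega⟩ hl
      have hmix := hbeta ⟨l, by omega⟩ hl
      rw [betaDist_eq_mixAdjDist, betaDist_eq_mixAdjDist] at hmix
      exact hsep.apply_eq_of_nodeWeightDist_eq hn hmix (hnode _) π
        fun i j _ => by simp [nodeSum, ih]
  have hg : ∀ (l : ℕ) (hl : l < d₁) (i j : Fin n), i ≠ j →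
      g' s(i, j) ⟨l, hl⟩ = g s(π i, π j) ⟨l, hl⟩ := by
    intro l
    induction l with
    | zero =>
      intro hl
      have hsep : AdjSeparated (nodeSum fun i => w i ⟨0, hd₂⟩) fun e => g e ⟨0, hl⟩ := by
        intro i j k m p q r h₁ h₂ h₃ h₄ h₅ h₆ h₇ h₈ h₉
        exact hypc i j k m p q r h₁ h₂ h₃ h₄ h₅ h₆ h₇ h₈ h₉
      rw [deltaDist_eq_mixAdjDist, deltaDist_eq_mixAdjDist] at hdelta
      exact hsep.apply_eq_of_edgeDist_eq hn hdelta (hedge _) π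
        fun i j _ => by simp [nodeSum, hπ]
    | succ l ih =>
      intro hl
      have hsep : AdjSeparated (fun e => g e ⟨l, by omega⟩) fun e => g e ⟨l + 1, hl⟩ := by
        intro i j k m p q r h₁ h₂ h₃ h₄ h₅ h₆ h₇ h₈ h₉
        exact hypb i j k m p q r h₁ h₂ h₃ h₄ h₅ h₆ h₇ h₈ h₉ ⟨l, by omega⟩ hl
      exact hsep.apply_eq_of_edgeDist_eq hn (halpha ⟨l, by omega⟩ hl) (hedge _) π (ih _)
  exact ⟨π, fun i j hij => funext fun l => hg l l.isLt i j hij,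
    fun i => funext fun l => hw l l.isLt i⟩
end
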